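/- The norm-trace curve N_{q,r}: X^{(q^r−1)/(q−1)} = Y^{q^{r-1}} + Y^{q^{r-2}} + ... + Y over the algebraic closure of F_p admits, for every b ∈ F_{q^r}*, the automorphism (x, y) ↦ (bx, b^{(q^r−1)/(q−1)} y), and for every a with Tr_{q^r|q}(a) = 0 the automorphism (x, y) ↦ (x, y + a); these generate a group of order q^{r−1}(q^r − 1) which is a semidirect product of the translation group by the cyclic group. -/

import Mathlib

/-- The "trace" map `y ↦ y^{q^{r-1}} + ... + y^q + y`. -/
def trMap (q r : ℕ) {K : Type*} [CommRing K] (y : K) : K :=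
  ∑ i ∈ Finset.range r, y ^ q ^ i

/-- The translation `(x, y) ↦ (x, y + a)` as a permutation of `K × K`. -/
def translationPerm {K : Type*} [Field K] (a : K) : Equiv.Perm (K × K) :=
  (Equiv.refl K).prodCongr (Equiv.addRight a)

/-- The scaling `(x, y) ↦ (b x, b^c y)` as a permutation of `K × K`. -/
noncomputable def scalingPerm {K : Type*} [Field K] (c : ℕ) (b : K) (hb : b ≠ 0) :
    Equiv.Perm (K × K) :=
  (Equiv.mulLeft₀ b hb).prodCongr (Equiv.mulLeft₀ (b ^ c) (pow_ne_zero c hb))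

section TraceMap

open Polynomial

variable {K : Type*} [Field K]

theorem trMap_add (p : ℕ) [Fact p.Prime] [CharP K p] (e r : ℕ) (x y : K) :
    trMap (p ^ e) r (x + y) = trMap (p ^ e) r x + trMap (p ^ e) r y := by
  simp only [trMap, ← pow_mul, add_pow_char_pow, Finset.sum_add_distrib]

theorem trMap_mul_of_pow_eq {q : ℕ} (r : ℕ) {l : K} (hl : l ^ q = l) (y : K) :
    trMap q r (l * y) = l * trMap q r y := by
  have h (i : ℕ) : l ^ q ^ i = l := by
    induction i with
    | zero => simp
    | succ i ih => rw [pow_succ, pow_mul, ih, hl]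
  simp only [trMap, mul_pow, h, Finset.mul_sum]

theorem pow_eq_self_of_trMap_eq_zero (p : ℕ) [Fact p.Prime] [CharP K p] (e r : ℕ) {a : K}
    (ha : trMap (p ^ e) r a = 0) : a ^ (p ^ e) ^ r = a := by
  have h : trMap (p ^ e) r a ^ p ^ e = ∑ i ∈ Finset.range r, a ^ (p ^ e) ^ (i + 1) := by
    simp only [trMap, sum_pow_char_pow, pow_succ, pow_mul]
  have h₀ := (Finset.sum_range_succ (fun i ↦ a ^ (p ^ e) ^ i) r).symm.trans
    (Finset.sum_range_succ' (fun i ↦ a ^ (p ^ e) ^ i) r)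
  rw [← h] at h₀
  change trMap (p ^ e) r a + _ = _ at h₀
  have hq : p ^ e ≠ 0 := pow_ne_zero _ (Fact.out : p.Prime).ne_zero
  simpa only [ha, zero_pow hq, zero_add, pow_zero, pow_one] using h₀

/-- The additive polynomial `X^{q^{r-1}} + ... + X^q + X`. -/
noncomputable def tracePoly (K : Type*) [Field K] (q r : ℕ) : K[X] :=
  ∑ i ∈ Finset.range r, X ^ q ^ i

theorem eval_tracePoly (q r : ℕ) (x : K) : (tracePoly K q r).eval x = trMap q r x := by
  simp [tracePoly, trMap, eval_finsetSum]

theorem natDegree_tracePoly {q : ℕ} (hq : 2 ≤ q) (s : ℕ) :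
    (tracePoly K q (s + 1)).natDegree = q ^ s := by
  induction s with
  | zero => simp [tracePoly]
  | succ s ih =>
    have h : tracePoly K q (s + 2) = tracePoly K q (s + 1) + X ^ q ^ (s + 1) :=
      Finset.sum_range_succ _ _
    rw [h, natDegree_add_eq_right_of_natDegree_lt, natDegree_X_pow]
    rw [ih, natDegree_X_pow]
    exact Nat.pow_lt_pow_right hq (Nat.lt_succ_self s)

theorem separable_tracePoly {q : ℕ} (hq : (q : K) = 0) (s : ℕ) :
    (tracePoly K q (s + 1)).Separable := by
  have h : derivative (tracePoly K q (s + 1)) = 1 := by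
    simp [tracePoly, Finset.sum_range_succ', derivative_X_pow, hq]
  rw [Separable, h]
  exact isCoprime_one_right

theorem card_trMap_eq_zero [IsAlgClosed K] {q : ℕ} (hq : 2 ≤ q) (hqK : (q : K) = 0) (s : ℕ) :
    Nat.card {a : K // trMap q (s + 1) a = 0} = q ^ s := by
  have hne : tracePoly K q (s + 1) ≠ 0 := (separable_tracePoly hqK s).ne_zero
  rw [← natDegree_tracePoly (K := K) hq s, ← card_rootSet_eq_natDegree (K := K)
    (separable_tracePoly hqK s) (IsAlgClosed.splits _), ← Nat.card_eq_fintype_card]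
  refine Nat.card_congr (Equiv.subtypeEquivRight fun a ↦ ?_)
  rw [mem_rootSet, coe_aeval_eq_eval, eval_tracePoly]
  simp [hne]

end TraceMap

section Permutations

variable {K : Type*} [Field K]

@[simp]
theorem translationPerm_apply (a : K) (z : K × K) : translationPerm a z = (z.1, z.2 + a) := rfl

@[simp]
theorem scalingPerm_apply (c : ℕ) (b : K) (hb : b ≠ 0) (z : K × K) :
    scalingPerm c b hb z = (b * z.1, b ^ c * z.2) := rfl

/-- Translations as a homomorphism from the additive group of the field. -/
def translationHom (K : Type*) [Field K] : Multiplicative K →* Equiv.Perm (K × K) where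
  toFun a := translationPerm a.toAdd
  map_one' := by ext z <;> simp
  map_mul' a b := by ext z <;> simp [add_left_comm, add_comm]

/-- Scalings as a homomorphism from the unit group of the field. -/
noncomputable def scalingHom (K : Type*) [Field K] (c : ℕ) : Kˣ →* Equiv.Perm (K × K) where
  toFun b := scalingPerm c b b.ne_zero
  map_one' := by ext z <;> simp
  map_mul' a b := by ext z <;> simp [mul_assoc, mul_pow]

theorem translationHom_injective : Function.Injective (translationHom K) := by
  intro a b h
  have := congrArg Prod.snd (DFunLike.congr_fun h (0, 0))
  simpa [translationHom] using this

theorem scalingHom_injective (c : ℕ) : Function.Injective (scalingHom K c) := by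
  intro a b h
  have := congrArg Prod.fst (DFunLike.congr_fun h (1, 0))
  simpa [scalingHom, Units.ext_iff] using this

theorem scalingPerm_conj_translationPerm (c : ℕ) (b : K) (hb : b ≠ 0) (a : K) :
    scalingPerm c b hb * translationPerm a * (scalingPerm c b hb)⁻¹ =
      translationPerm (b ^ c * a) := by
  rw [mul_inv_eq_iff_eq_mul]
  ext z <;> simp [mul_add]

/-- The translations by the elements of trace zero. -/
def traceZeroTranslations (K : Type*) [Field K] (p : ℕ) [Fact p.Prime] [CharP K p] (e r : ℕ) :
    Subgroup (Equiv.Perm (K × K)) :=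
  (AddSubgroup.toSubgroup
    (AddMonoidHom.mk' (trMap (p ^ e) r : K → K) (trMap_add p e r)).ker).map (translationHom K)

theorem mem_traceZeroTranslations (p : ℕ) [Fact p.Prime] [CharP K p] (e r : ℕ)
    (σ : Equiv.Perm (K × K)) :
    σ ∈ traceZeroTranslations K p e r ↔
      ∃ a : K, a ^ (p ^ e) ^ r = a ∧ trMap (p ^ e) r a = 0 ∧ σ = translationPerm a := by
  constructor
  · rintro ⟨a, ha, rfl⟩
    exact ⟨a.toAdd, pow_eq_self_of_trMap_eq_zero p e r ha, ha, rfl⟩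
  · rintro ⟨a, -, ha, rfl⟩
    exact ⟨Multiplicative.ofAdd a, ha, rfl⟩

theorem card_traceZeroTranslations [IsAlgClosed K] (p : ℕ) [Fact p.Prime] [CharP K p]
    {e : ℕ} (he : 1 ≤ e) (s : ℕ) :
    Nat.card (traceZeroTranslations K p e (s + 1)) = (p ^ e) ^ s := by
  have hp : p.Prime := Fact.out
  have hq : 2 ≤ p ^ e := hp.two_le.trans (Nat.le_self_pow (by omega) p)
  have hqK : ((p ^ e : ℕ) : K) = 0 := by
    rw [Nat.cast_pow, CharP.cast_eq_zero, zero_pow (by omega)]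
  rw [traceZeroTranslations, Subgroup.card_map_of_injective translationHom_injective,
    ← card_trMap_eq_zero hq hqK s]
  rfl

/-- The scalings by the `n`-th roots of unity. -/
noncomputable def rootScalings (K : Type*) [Field K] (c n : ℕ) : Subgroup (Equiv.Perm (K × K)) :=
  (rootsOfUnity n K).map (scalingHom K c)

theorem mem_rootScalings {m : ℕ} (hm : 1 ≤ m) (c : ℕ) (σ : Equiv.Perm (K × K)) :
    σ ∈ rootScalings K c (m - 1) ↔
      ∃ b : K, ∃ hb : b ≠ 0, b ^ m = b ∧ σ = scalingPerm c b hb := by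
  obtain ⟨m, rfl⟩ := Nat.exists_eq_add_of_le' hm
  have key (b : K) (hb : b ≠ 0) : b ^ (m + 1) = b ↔ b ^ m = 1 := by
    rw [pow_succ, mul_eq_right₀ hb]
  constructor
  · rintro ⟨b, hb, rfl⟩
    refine ⟨b, b.ne_zero, (key _ b.ne_zero).2 ?_, rfl⟩
    exact (mem_rootsOfUnity' m b).1 hb
  · rintro ⟨b, hb, h, rfl⟩
    exact ⟨Units.mk0 b hb, (mem_rootsOfUnity' m _).2 ((key b hb).1 h), rfl⟩

theorem isCyclic_rootScalings (c n : ℕ) [NeZero n] : IsCyclic (rootScalings K c n) :=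
  (((rootsOfUnity n K).equivMapOfInjective _ (scalingHom_injective c)).isCyclic).1 inferInstance

theorem card_rootScalings [IsAlgClosed K] (c n : ℕ) [NeZero (n : K)] :
    Nat.card (rootScalings K c n) = n := by
  have : NeZero n := NeZero.of_neZero_natCast K
  rw [rootScalings, Subgroup.card_map_of_injective (scalingHom_injective c),
    HasEnoughRootsOfUnity.natCard_rootsOfUnity]

end Permutations

theorem Subgroup.card_sup_of_disjoint_of_le_normalizer {G : Type*} [Group G] {N H : Subgroup G}
    (hd : Disjoint N H) (hH : H ≤ normalizer N) :
    Nat.card (N ⊔ H : Subgroup G) = Nat.card N * Nat.card H := by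
  rw [← Nat.card_prod, ← Nat.card_range_of_injective (Subgroup.mul_injective_of_disjoint hd)]
  refine Nat.card_congr (Equiv.setCongr ?_)
  rw [Subgroup.coe_mul_of_right_le_normalizer_left N H hH]
  ext g
  simp [Set.mem_mul]

theorem pow_geom_div_pow_eq {K : Type*} [Field K] {q r c : ℕ} (hq : 2 ≤ q)
    (hc : c = (q ^ r - 1) / (q - 1)) {b : K} (hb : b ≠ 0) (h : b ^ q ^ r = b) :
    (b ^ c) ^ q = b ^ c := by
  have hcq : c * (q - 1) = q ^ r - 1 := by
    rw [hc, Nat.div_mul_cancel (Nat.sub_one_dvd_pow_sub_one q r)]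
  have h₁ : b ^ (q ^ r - 1) = 1 := by
    rw [← mul_eq_right₀ hb, ← pow_succ, Nat.sub_add_cancel (Nat.one_le_pow _ _ (by omega)), h]
  obtain ⟨k, rfl⟩ := Nat.exists_eq_add_of_le' (show 1 ≤ q by omega)
  rw [pow_succ, ← pow_mul, show c * k = _ from hcq, h₁, one_mul]

theorem rootScalings_le_normalizer {K : Type*} [Field K] (p : ℕ) [Fact p.Prime] [CharP K p]
    (e r c : ℕ) (hq : 2 ≤ p ^ e) (hc : c = ((p ^ e) ^ r - 1) / (p ^ e - 1)) :
    rootScalings K c ((p ^ e) ^ r - 1) ≤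
      Subgroup.normalizer (traceZeroTranslations K p e r) := by
  rw [Subgroup.le_normalizer_iff]
  intro g hg t ht
  obtain ⟨b, hb, hbr, rfl⟩ := (mem_rootScalings (Nat.one_le_pow _ _ (by omega)) c g).1 hg
  obtain ⟨a, -, ha, rfl⟩ := (mem_traceZeroTranslations p e r t).1 ht
  have h : trMap (p ^ e) r (b ^ c * a) = 0 := by
    rw [trMap_mul_of_pow_eq r (pow_geom_div_pow_eq hq hc hb hbr), ha, mul_zero]
  rw [scalingPerm_conj_translationPerm]
  exact (mem_traceZeroTranslations p e r _).2 ⟨_, pow_eq_self_of_trMap_eq_zero p e r h, h, rfl⟩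

theorem disjoint_traceZeroTranslations_rootScalings {K : Type*} [Field K] (p : ℕ)
    [Fact p.Prime] [CharP K p] (e r c n : ℕ) :
    Disjoint (traceZeroTranslations K p e r) (rootScalings K c n) := by
  rw [Subgroup.disjoint_def]
  rintro _ ⟨a, -, rfl⟩ ⟨b, -, h⟩
  have h₁ := congrArg Prod.fst (DFunLike.congr_fun h (1, 0))
  have hb : b = 1 := by simpa [scalingHom, translationHom] using h₁
  rw [← h, hb, map_one]

/-- The norm-trace curve `X^{(q^r-1)/(q-1)} = Y^{q^{r-1}} + ... + Y` over the
algebraic closure of `F_p` admits, for every `b ∈ F_{q^r}*`, the automorphism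
`(x,y) ↦ (bx, b^{(q^r-1)/(q-1)} y)`, and for every `a ∈ F_{q^r}` with
`Tr_{q^r|q}(a) = 0` the automorphism `(x,y) ↦ (x, y+a)`; these generate a
group of order `q^{r-1}(q^r - 1)` which is a semidirect product of the
translation group by the cyclic group. -/
theorem stmt_7 (p : ℕ) (hp : p.Prime) (e r : ℕ) (he : 1 ≤ e) (hr : 2 ≤ r)
    (q : ℕ) (hq : q = p ^ e) {K : Type*} [Field K] [CharP K p] [IsAlgClosed K]
    (c : ℕ) (hc : c = (q ^ r - 1) / (q - 1)) :
    (∀ a : K, a ^ q ^ r = a → trMap q r a = 0 →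
      ∀ x y : K, x ^ c = trMap q r y → x ^ c = trMap q r (y + a)) ∧
    (∀ b : K, b ≠ 0 → b ^ q ^ r = b →
      ∀ x y : K, x ^ c = trMap q r y → (b * x) ^ c = trMap q r (b ^ c * y)) ∧
    (∀ G : Subgroup (Equiv.Perm (K × K)),
      G = Subgroup.closure
        ({σ | ∃ a : K, a ^ q ^ r = a ∧ trMap q r a = 0 ∧ σ = translationPerm a} ∪
         {σ | ∃ b : K, ∃ hb : b ≠ 0, b ^ q ^ r = b ∧ σ = scalingPerm c b hb}) →
      Nat.card G = q ^ (r - 1) * (q ^ r - 1) ∧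
      ∃ T C : Subgroup (Equiv.Perm (K × K)),
        (∀ σ, σ ∈ T ↔ ∃ a : K, a ^ q ^ r = a ∧ trMap q r a = 0 ∧ σ = translationPerm a) ∧
        T ≤ G ∧ C ≤ G ∧ (∀ g ∈ G, ∀ t ∈ T, g * t * g⁻¹ ∈ T) ∧
        T ⊓ C = ⊥ ∧ T ⊔ C = G ∧ IsCyclic C ∧
        Nat.card T = q ^ (r - 1) ∧ Nat.card C = q ^ r - 1) := by
  have hp' : Fact p.Prime := ⟨hp⟩
  subst hq
  have hq : 2 ≤ p ^ e := hp.two_le.trans (Nat.le_self_pow (by omega) p)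
  refine ⟨fun a _ ha x y h ↦ ?_, fun b hb hbr x y h ↦ ?_, ?_⟩
  · rw [trMap_add, ha, add_zero, h]
  · rw [mul_pow, h, trMap_mul_of_pow_eq r (pow_geom_div_pow_eq hq hc hb hbr)]
  rintro G rfl
  have hqr : 2 ≤ (p ^ e) ^ r := hq.trans (Nat.le_self_pow (by omega) _)
  set T := traceZeroTranslations K p e r
  set C := rootScalings K c ((p ^ e) ^ r - 1)
  have hG : Subgroup.closure
      ({σ | ∃ a : K, a ^ (p ^ e) ^ r = a ∧ trMap (p ^ e) r a = 0 ∧ σ = translationPerm a} ∪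
        {σ | ∃ b : K, ∃ hb : b ≠ 0, b ^ (p ^ e) ^ r = b ∧ σ = scalingPerm c b hb}) = T ⊔ C := by
    rw [← Subgroup.closure_eq T, ← Subgroup.closure_eq C, ← Subgroup.closure_union]
    congr 2
    · ext σ
      exact (mem_traceZeroTranslations p e r σ).symm
    · ext σ
      exact (mem_rootScalings (by omega) c σ).symm
  have hN : C ≤ Subgroup.normalizer T := rootScalings_le_normalizer p e r c hq hc
  have hd : Disjoint T C := disjoint_traceZeroTranslations_rootScalings p e r c _
  have hn : (((p ^ e) ^ r - 1 : ℕ) : K) ≠ 0 := by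
    rw [Nat.cast_sub (by omega), Nat.cast_pow, Nat.cast_pow, CharP.cast_eq_zero,
      zero_pow (by omega), zero_pow (by omega)]
    simp
  have : NeZero (((p ^ e) ^ r - 1 : ℕ) : K) := ⟨hn⟩
  have : NeZero ((p ^ e) ^ r - 1) := NeZero.of_neZero_natCast K
  have hT : Nat.card T = (p ^ e) ^ (r - 1) := by
    have h := card_traceZeroTranslations (K := K) p he (r - 1)
    rwa [Nat.sub_add_cancel (by omega)] at h
  have hC : Nat.card C = (p ^ e) ^ r - 1 := card_rootScalings c _
  rw [hG]
  refine ⟨?_, T, C, mem_traceZeroTranslations p e r, le_sup_left, le_sup_right,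
    Subgroup.le_normalizer_iff.1 (sup_le Subgroup.le_normalizer hN), hd.eq_bot, rfl,
    isCyclic_rootScalings c _, hT, hC⟩
  rw [Subgroup.card_sup_of_disjoint_of_le_normalizer hd hN, hT, hC]
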